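/- For every even integer n ≥ 8 and every real number x ≥ 3/π, Alt_x(F_n) > 0, where F_n is the polynomial function F_n(y) = −C_n·y − (C_{n−4}/12)·y³ + (C_{n−6}/12)·y⁵ and Alt_x(f) := Σ_{k≥0} ((−1)^k/(2k+1)) · f( (−1)^k·x/(2k+1) ) (the series converges for polynomial f). -/

import Mathlib

/-- `C_{2r} = 2·((r−1)!)²/(2r)!` for `r ≥ 1` (so `C_2 = 1`), the Taylor
coefficients of `4·arcsin(z/2)² = Σ_{r≥1} C_{2r} z^{2r}`. -/
noncomputable def Ccoef (m : ℕ) : ℝ :=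
  2 * ((m / 2 - 1).factorial : ℝ) ^ 2 / (m.factorial : ℝ)

/-- `F_n(y) = −C_n·y − (C_{n−4}/12)·y³ + (C_{n−6}/12)·y⁵`. -/
noncomputable def Ffun (n : ℕ) (y : ℝ) : ℝ :=
  -Ccoef n * y - (Ccoef (n - 4) / 12) * y ^ 3 + (Ccoef (n - 6) / 12) * y ^ 5

lemma C_step (r : ℕ) : Ccoef (2 * r + 4) ≤ Ccoef (2 * r + 2) / 4 := by
  unfold Ccoef
  have h1 : (2 * r + 4) / 2 - 1 = r + 1 := by omega
  have h2 : (2 * r + 2) / 2 - 1 = r := by omega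
  rw [h1, h2, Nat.factorial_succ (2 * r + 3), Nat.factorial_succ (2 * r + 2), Nat.factorial_succ r]
  push_cast
  have hF : (0 : ℝ) < ((2 * r + 2).factorial : ℝ) := by positivity
  have hr : (0 : ℝ) < (r.factorial : ℝ) := by positivity
  rw [div_div, div_le_div_iff₀ (by positivity) (by positivity)]
  have : (0 : ℝ) ≤ 2 * (r.factorial : ℝ) ^ 2 * ((2 * r + 2).factorial : ℝ) := by positivity
  have hr0 : (0 : ℝ) ≤ r := by positivity
  have h3 : ((r : ℝ) + 1) ^ 2 * 4 ≤ (2 * r + 3 + 1) * (2 * r + 2 + 1) := by nlinarith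
  nlinarith [mul_le_mul_of_nonneg_left h3 this]

lemma C_pos (m : ℕ) : 0 < Ccoef m := by
  unfold Ccoef
  positivity

lemma odd_inj : Function.Injective (fun k : ℕ => 2 * k + 1) := by
  intro a b h
  simp only at h
  omega

lemma summ_odd (p : ℕ) (hp : 2 ≤ p) : Summable (fun k : ℕ => 1 / ((2 * k + 1 : ℝ)) ^ p) := by
  have h := (Real.summable_one_div_nat_pow.mpr (show 1 < p by omega)).comp_injective odd_inj
  refine h.congr fun k => ?_
  simp

lemma l2_le : ∑' k : ℕ, 1 / ((2 * k + 1 : ℝ)) ^ 2 ≤ Real.pi ^ 2 / 6 := by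
  rw [← hasSum_zeta_two.tsum_eq]
  refine Summable.tsum_le_tsum_of_inj (fun k : ℕ => 2 * k + 1) odd_inj ?_ ?_
    (summ_odd 2 le_rfl) hasSum_zeta_two.summable
  · intro c _
    positivity
  · intro k
    simp

lemma l4_le : ∑' k : ℕ, 1 / ((2 * k + 1 : ℝ)) ^ 4 ≤ ∑' k : ℕ, 1 / ((2 * k + 1 : ℝ)) ^ 2 := by
  refine Summable.tsum_le_tsum (fun k => ?_) (summ_odd 4 (by norm_num)) (summ_odd 2 le_rfl)
  have : (1 : ℝ) ≤ 2 * k + 1 := by linarith [(Nat.cast_nonneg k : (0 : ℝ) ≤ k)]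
  exact one_div_le_one_div_of_le (by positivity) (pow_le_pow_right₀ this (by norm_num))

lemma l6_ge : 1 ≤ ∑' k : ℕ, 1 / ((2 * k + 1 : ℝ)) ^ 6 := by
  have := (summ_odd 6 (by norm_num)).le_tsum 0 (fun k _ => by positivity)
  simpa using this

theorem Alt_F_pos (n : ℕ) (hn : 8 ≤ n) (hne : Even n)
    (x : ℝ) (hx : 3 / Real.pi ≤ x) :
    Summable (fun k : ℕ => ((-1 : ℝ) ^ k / (2 * k + 1)) *
        Ffun n ((-1 : ℝ) ^ k * x / (2 * k + 1))) ∧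
    0 < ∑' k : ℕ, ((-1 : ℝ) ^ k / (2 * k + 1)) *
        Ffun n ((-1 : ℝ) ^ k * x / (2 * k + 1)) := by
  obtain ⟨s, rfl⟩ : ∃ s, n = 2 * s + 8 := by
    obtain ⟨m, rfl⟩ := hne
    exact ⟨m - 4, by omega⟩
  have e1 : 2 * s + 8 - 4 = 2 * s + 4 := by omega
  have e2 : 2 * s + 8 - 6 = 2 * s + 2 := by omega
  have c1 := C_step s
  have c2 := C_step (s + 1)
  have c3 := C_step (s + 2)
  rw [show 2 * (s + 1) + 4 = 2 * s + 6 by ring, show 2 * (s + 1) + 2 = 2 * s + 4 by ring] at c2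
  rw [show 2 * (s + 2) + 4 = 2 * s + 8 by ring, show 2 * (s + 2) + 2 = 2 * s + 6 by ring] at c3
  have cp := C_pos (2 * s + 2)
  have cp4 := C_pos (2 * s + 4)
  have cp8 := C_pos (2 * s + 8)
  have hS := (((summ_odd 2 le_rfl).hasSum.mul_left (-Ccoef (2 * s + 8) * x)).add
    ((summ_odd 4 (by norm_num)).hasSum.mul_left (-(Ccoef (2 * s + 4) / 12) * x ^ 3))).add
    ((summ_odd 6 (by norm_num)).hasSum.mul_left ((Ccoef (2 * s + 2) / 12) * x ^ 5))
  have hfun : (fun k : ℕ => ((-1 : ℝ) ^ k / (2 * k + 1)) *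
        Ffun (2 * s + 8) ((-1 : ℝ) ^ k * x / (2 * k + 1))) = fun k : ℕ =>
      -Ccoef (2 * s + 8) * x * (1 / (2 * k + 1 : ℝ) ^ 2) +
      -(Ccoef (2 * s + 4) / 12) * x ^ 3 * (1 / (2 * k + 1 : ℝ) ^ 4) +
      (Ccoef (2 * s + 2) / 12) * x ^ 5 * (1 / (2 * k + 1 : ℝ) ^ 6) := by
    funext k
    unfold Ffun
    rw [e1, e2]
    have : (2 * k + 1 : ℝ) ≠ 0 := by positivity
    rcases neg_one_pow_eq_or ℝ k with h | h <;> rw [h] <;> field_simp <;> ring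
  rw [hfun]
  refine ⟨hS.summable, ?_⟩
  rw [hS.tsum_eq]
  have a2 := l2_le
  have a4 := l4_le
  have a6 := l6_ge
  generalize (∑' k : ℕ, 1 / ((2 * k + 1 : ℝ)) ^ 2) = A2 at *
  generalize (∑' k : ℕ, 1 / ((2 * k + 1 : ℝ)) ^ 4) = A4 at *
  generalize (∑' k : ℕ, 1 / ((2 * k + 1 : ℝ)) ^ 6) = A6 at *
  have hpi : Real.pi < 3.15 := Real.pi_lt_d2
  have hpi0 := Real.pi_pos
  have hA2 : A2 ≤ 1.654 := by nlinarith
  have hx0 : 20 / 21 ≤ x := by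
    refine le_trans ?_ hx
    rw [le_div_iff₀ hpi0]
    linarith
  have hxp : 0 < x := by linarith
  generalize Ccoef (2 * s + 2) = a at *
  generalize Ccoef (2 * s + 4) = b at *
  generalize Ccoef (2 * s + 8) = c at *
  have hc : c ≤ a / 64 := by linarith
  have ht : (0.907 : ℝ) ≤ x ^ 2 := by nlinarith
  have k1 : c * A2 ≤ a / 64 * 1.654 :=
    (mul_le_mul_of_nonneg_left hA2 cp8.le).trans (by nlinarith)
  have k2 : b * A4 ≤ a / 4 * 1.654 :=
    (mul_le_mul_of_nonneg_left (a4.trans hA2) cp4.le).trans (by nlinarith)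
  have k2' := mul_le_mul_of_nonneg_right k2 (sq_nonneg x)
  have k3 : a * x ^ 4 ≤ a * A6 * x ^ 4 := by
    have : 0 ≤ a * x ^ 4 := by positivity
    nlinarith
  have k4 : 0 < x ^ 4 / 12 - x ^ 2 * (1.654 / 48) - 1.654 / 64 := by nlinarith
  have k5 := mul_pos cp k4
  have k6 : 0 < -(c * A2) - (b * A4 * x ^ 2) / 12 + (a * A6 * x ^ 4) / 12 := by linarith
  have := mul_pos hxp k6
  linarith
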